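/- Let E be a finite homogeneous effect algebra. If S(E) = {0, 1}, then E is a lattice (every pair of elements of E has a greatest lower bound and a least upper bound with respect to the effect-algebra order). -/

import Mathlib

namespace EffectAlgebraPaper

/-- An effect algebra: a set with 0, 1 and a partially defined sum `add`,
whose domain is the relation `Orth` (written `a ⊥ b` in the paper). -/
class EffectAlgebra (E : Type*) where
  zero : E
  one : E
  /-- `Orth a b` means `a ⊕ b` is defined. -/
  Orth : E → E → Prop
  /-- The sum `a ⊕ b`, meaningful only when `Orth a b`. -/
  add : E → E → E
  orth_comm : ∀ a b : E, Orth a b → Orth b a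
  add_comm : ∀ a b : E, Orth a b → add a b = add b a
  assoc : ∀ a b c : E, Orth b c → Orth a (add b c) →
    Orth a b ∧ Orth (add a b) c ∧ add a (add b c) = add (add a b) c
  compl_exists : ∀ a : E, ∃! b : E, Orth a b ∧ add a b = one
  orth_one : ∀ a : E, Orth a one → a = zero

namespace EffectAlgebra

variable {E : Type*} [EffectAlgebra E]

/-- The orthosupplement `a'`. -/
noncomputable def compl (a : E) : E := (compl_exists a).exists.choose

/-- The effect-algebra partial order: `a ≤ b` iff `a ⊕ c = b` for some `c`. -/
def le (a b : E) : Prop := ∃ c : E, Orth a c ∧ add a c = b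

/-- The interval `[x, y] = {z : x ≤ z ≤ y}`. -/
def Interval (x y : E) : Set E := { z : E | le x z ∧ le z y }

/-- An atom: a minimal nonzero element. -/
def Atom (a : E) : Prop := a ≠ zero ∧ ∀ b : E, b ≠ zero → le b a → b = a

/-- A sharp element: the only common lower bound of `x` and `x'` is `0`. -/
def Sharp (x : E) : Prop := ∀ b : E, le b x → le b (compl x) → b = zero

/-- `S(E)`, the set of sharp elements. -/
def sharpSet (E : Type*) [EffectAlgebra E] : Set E := { x : E | Sharp x }

/-- Homogeneity: `u ≤ v₁ ⊕ v₂ ≤ u'` implies `u = u₁ ⊕ u₂` with `u₁ ≤ v₁`, `u₂ ≤ v₂`. -/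
def Homogeneous (E : Type*) [EffectAlgebra E] : Prop :=
  ∀ u v₁ v₂ : E, Orth v₁ v₂ → le u (add v₁ v₂) → le (add v₁ v₂) (compl u) →
    ∃ u₁ u₂ : E, le u₁ v₁ ∧ le u₂ v₂ ∧ Orth u₁ u₂ ∧ add u₁ u₂ = u

/-- `nmul n a` is the iterated sum `n·a = a ⊕ ⋯ ⊕ a` (`n` times), with `0·a = 0`;
it is meaningful only when `nmulDef n a` holds. -/
def nmul : ℕ → E → E
  | 0, _ => zero
  | n + 1, a => add (nmul n a) a

/-- `nmulDef n a` says the iterated sum `n·a` is well defined. -/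
def nmulDef : ℕ → E → Prop
  | 0, _ => True
  | n + 1, a => nmulDef n a ∧ Orth (nmul n a) a

end EffectAlgebra

open EffectAlgebra

namespace EffectAlgebra

variable {E : Type*} [EffectAlgebra E]

theorem orth_compl (a : E) : Orth a (compl a) :=
  (compl_exists a).exists.choose_spec.1

theorem add_compl (a : E) : add a (compl a) = one :=
  (compl_exists a).exists.choose_spec.2

theorem eq_compl {a b : E} (h : Orth a b) (hab : add a b = one) : b = compl a :=
  (compl_exists a).unique ⟨h, hab⟩ ⟨orth_compl a, add_compl a⟩

theorem compl_compl' (a : E) : compl (compl a) = a :=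
  (eq_compl (orth_comm _ _ (orth_compl a))
    ((add_comm _ _ (orth_comm _ _ (orth_compl a))).trans (add_compl a))).symm

theorem assoc_right {a b c : E} (hab : Orth a b) (h : Orth (add a b) c) :
    Orth b c ∧ Orth a (add b c) ∧ add (add a b) c = add a (add b c) := by
  have hba := orth_comm _ _ hab
  have h' := orth_comm _ _ h
  rw [add_comm _ _ hab] at h'
  obtain ⟨h1, h2, h3⟩ := assoc c b a hba h'
  have h1' := orth_comm _ _ h1
  rw [add_comm _ _ h1] at h2 h3
  refine ⟨h1', orth_comm _ _ h2, ?_⟩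
  rw [add_comm _ _ h, add_comm _ _ hab, h3, add_comm _ _ h2]

theorem add_right_comm' {a b c : E} (hab : Orth a b) (h : Orth (add a b) c) :
    Orth a c ∧ Orth (add a c) b ∧ add (add a b) c = add (add a c) b := by
  obtain ⟨h1, h2, h3⟩ := assoc_right hab h
  rw [add_comm _ _ h1] at h2 h3
  obtain ⟨h4, h5, h6⟩ := assoc a c b (orth_comm _ _ h1) h2
  exact ⟨h4, h5, h3.trans h6⟩

theorem compl_one : compl (one : E) = zero :=
  orth_one _ (orth_comm _ _ (orth_compl one))

theorem zero_orth (a : E) : Orth zero a ∧ add zero a = a := by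
  have h : Orth (zero : E) (add a (compl a)) := by
    rw [add_compl, ← compl_one]
    exact orth_comm _ _ (orth_compl one)
  obtain ⟨h1, h2, h3⟩ := assoc _ _ _ (orth_compl a) h
  refine ⟨h1, ?_⟩
  have h4 : add (zero : E) one = one := by
    rw [← compl_one, add_comm _ _ (orth_comm _ _ (orth_compl one)), add_compl]
  rw [add_compl, h4] at h3
  rw [add_comm _ _ h2] at h3
  rw [eq_compl (orth_comm _ _ h2) h3.symm, compl_compl']

theorem orth_zero (a : E) : Orth a zero := orth_comm _ _ (zero_orth a).1

theorem add_zero' (a : E) : add a zero = a := by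
  rw [add_comm _ _ (orth_zero a), (zero_orth a).2]

theorem add_left_cancel' {a b c : E} (hb : Orth a b) (hc : Orth a c)
    (h : add a b = add a c) : b = c := by
  have hd := orth_comm _ _ (orth_compl (add a b))
  have hd1 : add (compl (add a b)) (add a b) = one := by
    rw [add_comm _ _ hd, add_compl]
  obtain ⟨-, h2, h3⟩ := assoc _ _ _ hb hd
  have hd' : Orth (compl (add a b)) (add a c) := h ▸ hd
  obtain ⟨-, h5, h6⟩ := assoc _ _ _ hc hd'
  rw [eq_compl h2 (h3.symm.trans hd1), eq_compl h5 (h6.symm.trans (h ▸ hd1))]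

theorem eq_zero_of_add_eq_zero {a b : E} (h : Orth a b) (h0 : add a b = zero) : a = zero := by
  have h1 : Orth one (add a b) := h0 ▸ orth_zero one
  exact orth_one _ (orth_comm _ _ (assoc _ _ _ h h1).1)

theorem le_refl' (a : E) : le a a := ⟨zero, orth_zero a, add_zero' a⟩

theorem zero_le' (a : E) : le zero a := ⟨a, zero_orth a⟩

theorem le_one' (a : E) : le a one := ⟨compl a, orth_compl a, add_compl a⟩

theorem le_add {a b : E} (h : Orth a b) : le a (add a b) := ⟨b, h, rfl⟩

theorem le_trans' {a b c : E} (hab : le a b) (hbc : le b c) : le a c := by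
  obtain ⟨r, hr, rfl⟩ := hab
  obtain ⟨t, ht, rfl⟩ := hbc
  obtain ⟨-, h2, h3⟩ := assoc_right hr ht
  exact ⟨_, h2, h3.symm⟩

theorem eq_zero_of_add_le {a b : E} (h : Orth a b) (hle : le (add a b) a) : b = zero := by
  obtain ⟨t, ht, hta⟩ := hle
  obtain ⟨h1, h2, h3⟩ := assoc_right h ht
  refine eq_zero_of_add_eq_zero h1 (add_left_cancel' h2 (orth_zero a) ?_)
  rw [← h3, hta, add_zero']

theorem le_antisymm' {a b : E} (hab : le a b) (hba : le b a) : a = b := by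
  obtain ⟨r, hr, rfl⟩ := hab
  rw [eq_zero_of_add_le hr hba, add_zero']

theorem orth_iff_le_compl {a b : E} : Orth a b ↔ le a (compl b) := by
  constructor
  · intro h
    obtain ⟨h1, h2, h3⟩ := add_right_comm' h (orth_compl (add a b))
    rw [add_compl, add_comm _ _ h2] at h3
    exact ⟨_, h1, eq_compl (orth_comm _ _ h2) h3.symm⟩
  · rintro ⟨d, hd, hdb⟩
    have h : Orth b (add a d) := hdb ▸ orth_compl b
    exact orth_comm _ _ (assoc _ _ _ hd h).1

theorem Orth.mono_left {a b c : E} (hab : le a b) (h : Orth b c) : Orth a c :=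
  orth_iff_le_compl.2 (le_trans' hab (orth_iff_le_compl.1 h))

theorem compl_le_compl {a b : E} (h : le a b) : le (compl b) (compl a) :=
  orth_iff_le_compl.1 (orth_comm _ _ (Orth.mono_left h (orth_compl b)))

theorem le_of_compl_le_compl {a b : E} (h : le (compl b) (compl a)) : le a b := by
  simpa only [compl_compl'] using compl_le_compl h

theorem add_le_add_right' {a b c : E} (hab : le a b) (h : Orth b c) :
    le (add a c) (add b c) := by
  obtain ⟨r, hr, rfl⟩ := hab
  obtain ⟨-, h2, h3⟩ := add_right_comm' hr h
  exact ⟨r, h2, h3.symm⟩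

/-- The effect-algebra order as a Mathlib partial order. -/
abbrev toPartialOrder (E : Type*) [EffectAlgebra E] : PartialOrder E where
  le := le
  le_refl := le_refl'
  le_trans _ _ _ := le_trans'
  le_antisymm _ _ := le_antisymm'

theorem exists_maximal_mem [Finite E] {s : Set E} (hs : s.Nonempty) :
    ∃ m ∈ s, ∀ x ∈ s, le m x → le x m := by
  let _ := toPartialOrder E
  obtain ⟨m, hm⟩ := s.toFinite.exists_maximal hs
  exact ⟨m, hm.1, fun x hx h => hm.2 hx h⟩

theorem exists_atom_le [Finite E] {x : E} (hx : x ≠ zero) : ∃ a : E, Atom a ∧ le a x := by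
  let _ := toPartialOrder E
  obtain ⟨m, hm⟩ := (Set.toFinite {z : E | z ≠ zero ∧ le z x}).exists_minimal
    ⟨x, hx, le_refl' x⟩
  exact ⟨m, ⟨hm.1.1, fun b hb hbm =>
    le_antisymm' hbm (hm.2 ⟨hb, le_trans' hbm hm.1.2⟩ hbm)⟩, hm.1.2⟩

/-- If `S(E) = {0, 1}`, every other element has an atom in common with its orthosupplement. -/
theorem exists_atom_le_orth [Finite E] (hS : sharpSet E = {zero, one}) {x : E}
    (h0 : x ≠ zero) (h1 : x ≠ one) : ∃ c : E, Atom c ∧ le c x ∧ Orth c x := by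
  have hx : ¬ Sharp x := fun h => by
    have : x ∈ ({zero, one} : Set E) := hS ▸ h
    rcases this with h | h
    exacts [h0 h, h1 h]
  unfold Sharp at hx
  push Not at hx
  obtain ⟨b, hb1, hb2, hb⟩ := hx
  obtain ⟨c, hc, hcb⟩ := exists_atom_le hb
  exact ⟨c, hc, le_trans' hcb hb1, orth_iff_le_compl.2 (le_trans' hcb hb2)⟩

theorem Homogeneous.atom_le_or_le (hhom : Homogeneous E) {c v w : E} (hc : Atom c)
    (hvw : Orth v w) (hle : le c (add v w)) (ho : Orth c (add v w)) : le c v ∨ le c w := by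
  obtain ⟨c₁, c₂, h1, h2, h12, rfl⟩ :=
    hhom c v w hvw hle (orth_iff_le_compl.1 (orth_comm _ _ ho))
  by_cases h : c₁ = zero
  · subst h
    rw [(zero_orth c₂).2]
    exact Or.inr h2
  · rw [← hc.2 c₁ h (le_add h12)]
    exact Or.inl h1

/-- `IsMultiple a p` says that `p` is an iterated sum of copies of `a`. -/
inductive IsMultiple (a : E) : E → Prop
  | zero : IsMultiple a zero
  | add {p : E} : IsMultiple a p → Orth p a → IsMultiple a (add p a)

theorem isMultiple_self (a : E) : IsMultiple a a := by
  have h := IsMultiple.add IsMultiple.zero (zero_orth a).1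
  rwa [(zero_orth a).2] at h

theorem IsMultiple.le_total {a p : E} (hp : IsMultiple a p) :
    ∀ {q : E}, IsMultiple a q → le p q ∨ le q p := by
  induction hp with
  | zero => exact fun _ => Or.inl (zero_le' _)
  | @add p hp hpa ih =>
    intro q hq
    cases hq with
    | zero => exact Or.inr (zero_le' _)
    | add hq hqa =>
      exact (ih hq).imp (fun h => add_le_add_right' h hqa) (fun h => add_le_add_right' h hpa)

theorem IsMultiple.atom_eq (hhom : Homogeneous E) {a c p : E} (ha : Atom a) (hc : Atom c)
    (hp : IsMultiple a p) (hle : le c p) (ho : Orth c p) : c = a := by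
  induction hp with
  | zero => exact absurd (le_antisymm' hle (zero_le' c)) hc.1
  | @add p hp hpa ih =>
    rcases hhom.atom_le_or_le hc hpa hle ho with h | h
    · exact ih h (orth_comm _ _ (Orth.mono_left (le_add hpa) (orth_comm _ _ ho)))
    · exact ha.2 c hc.1 h

theorem ne_zero_of_atom_le {a x : E} (ha : Atom a) (h : le a x) : x ≠ zero := by
  rintro rfl
  exact ha.1 (le_antisymm' h (zero_le' a))

theorem exists_isMultiple_add_eq_one [Finite E] (hhom : Homogeneous E)
    (hS : sharpSet E = {zero, one}) {a b : E} (ha : Atom a) (hb : Atom b) (hab : Orth a b) :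
    ∃ p q : E, IsMultiple a p ∧ IsMultiple b q ∧ le a p ∧ le b q ∧
      Orth p q ∧ add p q = one := by
  obtain ⟨w, ⟨p, q, hp, hq, hap, hbq, hpq, rfl⟩, hmax⟩ := exists_maximal_mem
    (s := {w : E | ∃ p q : E, IsMultiple a p ∧ IsMultiple b q ∧ le a p ∧ le b q ∧
      Orth p q ∧ add p q = w})
    ⟨_, a, b, isMultiple_self a, isMultiple_self b, le_refl' a, le_refl' b, hab, rfl⟩
  refine ⟨p, q, hp, hq, hap, hbq, hpq, ?_⟩
  by_contra h1
  obtain ⟨c, hc, hcw, hco⟩ := exists_atom_le_orth hS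
    (ne_zero_of_atom_le ha (le_trans' hap (le_add hpq))) h1
  have hwc := orth_comm _ _ hco
  refine hc.1 (eq_zero_of_add_le hwc (hmax _ ?_ (le_add hwc)))
  rcases hhom.atom_le_or_le hc hpq hcw hco with h | h
  · obtain ⟨h2, h3, h4⟩ := add_right_comm' hpq hwc
    obtain rfl := hp.atom_eq hhom ha hc h (orth_comm _ _ h2)
    exact ⟨_, q, hp.add h2, hq, le_trans' hap (le_add h2), hbq, h3, h4.symm⟩
  · obtain ⟨h2, h3, h4⟩ := assoc_right hpq hwc
    obtain rfl := hq.atom_eq hhom hb hc h (orth_comm _ _ h2)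
    exact ⟨p, _, hp, hq.add h2, hap, le_trans' hbq (le_add h2), h3, h4.symm⟩

theorem atom_eq_of_orth [Finite E] (hhom : Homogeneous E) (hS : sharpSet E = {zero, one})
    {a b : E} (ha : Atom a) (hb : Atom b) (hab : Orth a b) : a = b := by
  obtain ⟨p, q, hp, hq, hap, hbq, hpq, h1⟩ :=
    exists_isMultiple_add_eq_one hhom hS ha hb hab
  have hp1 : p ≠ one := by
    rintro rfl
    exact ne_zero_of_atom_le hb hbq (orth_one q (orth_comm _ _ hpq))
  obtain ⟨c, hc, hcp, hco⟩ := exists_atom_le_orth hS (ne_zero_of_atom_le ha hap) hp1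
  have hcq : le c q := by
    rw [eq_compl hpq h1]
    exact orth_iff_le_compl.1 hco
  rw [← hp.atom_eq hhom ha hc hcp hco,
    hq.atom_eq hhom hb hc hcq (Orth.mono_left hcp hpq)]

theorem isMultiple_of_atom_le [Finite E] (hhom : Homogeneous E)
    (hS : sharpSet E = {zero, one}) {a x : E} (ha : Atom a) (hax : le a x) :
    IsMultiple a x := by
  obtain ⟨p, ⟨hp, hap, y, hpy, rfl⟩, hmax⟩ := exists_maximal_mem
    (s := {p : E | IsMultiple a p ∧ le a p ∧ le p x})
    ⟨a, isMultiple_self a, le_refl' a, hax⟩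
  by_cases hy : y = zero
  · rwa [hy, add_zero']
  obtain ⟨b, hb, t, hbt, rfl⟩ := exists_atom_le hy
  obtain ⟨hpb, h2, h3⟩ := assoc _ _ _ hbt hpy
  obtain rfl := atom_eq_of_orth hhom hS ha hb (Orth.mono_left hap hpb)
  refine absurd (eq_zero_of_add_le hpb (hmax _ ?_ (le_add hpb))) ha.1
  exact ⟨hp.add hpb, le_trans' hap (le_add hpb), t, h2, h3.symm⟩

theorem le_total_of_common_lower_bound [Finite E] (hhom : Homogeneous E)
    (hS : sharpSet E = {zero, one}) {x y z : E} (hz : z ≠ zero) (hx : le z x) (hy : le z y) :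
    le x y ∨ le y x := by
  obtain ⟨a, ha, haz⟩ := exists_atom_le hz
  exact (isMultiple_of_atom_le hhom hS ha (le_trans' haz hx)).le_total
    (isMultiple_of_atom_le hhom hS ha (le_trans' haz hy))

end EffectAlgebra

/-- Corollary 3 (cor3): a finite homogeneous effect algebra with `S(E) = {0, 1}` is a
lattice: every pair of elements has a greatest lower bound and a least upper bound
with respect to the effect-algebra order. -/
theorem stmt11 {E : Type*} [EffectAlgebra E] [Finite E] (hhom : Homogeneous E)
    (hS : sharpSet E = {zero, one}) :
    ∀ x y : E,
      (∃ m : E, le m x ∧ le m y ∧ ∀ z : E, le z x → le z y → le z m) ∧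
      (∃ s : E, le x s ∧ le y s ∧ ∀ z : E, le x z → le y z → le s z) := by
  intro x y
  by_cases hxy : le x y
  · exact ⟨⟨x, le_refl' x, hxy, fun _ h _ => h⟩, ⟨y, hxy, le_refl' y, fun _ _ h => h⟩⟩
  by_cases hyx : le y x
  · exact ⟨⟨y, hyx, le_refl' y, fun _ _ h => h⟩, ⟨x, le_refl' x, hyx, fun _ h _ => h⟩⟩
  refine ⟨⟨zero, zero_le' x, zero_le' y, fun z hzx hzy => ?_⟩,
    ⟨one, le_one' x, le_one' y, fun z hxz hyz => ?_⟩⟩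
  · by_contra h
    have hz : z ≠ zero := fun h0 => h (h0 ▸ le_refl' z)
    exact (le_total_of_common_lower_bound hhom hS hz hzx hzy).elim hxy hyx
  · by_contra h
    have hz : compl z ≠ zero := fun h0 => h (by
      rw [← compl_compl' z, h0, ← compl_one, compl_compl']
      exact le_refl' one)
    exact (le_total_of_common_lower_bound hhom hS hz (compl_le_compl hxz)
      (compl_le_compl hyz)).elim (fun h => hyx (le_of_compl_le_compl h))
      (fun h => hxy (le_of_compl_le_compl h))

end EffectAlgebraPaper
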